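/- Let G = (V,E) be a paw-free finite simple graph (containing no induced subgraph isomorphic to the paw, i.e., a triangle with one additional pendant vertex). Then there exists an optimal STC-labeling L = (S,W) of G such that the spanning subgraph (V,S) is a cluster graph, i.e., every connected component of (V,S) is a clique. -/

import Mathlib

/-- An STC-labeling of a simple graph `G`, given by its set `S` of strong edges
(the weak edges are `G.edgeSet \ S`). -/
def IsSTCLabeling {V : Type*} (G : SimpleGraph V) (S : Set (Sym2 V)) : Prop :=
  S ⊆ G.edgeSet ∧ ∀ u v w : V, s(u, v) ∈ S → s(v, w) ∈ S → u ≠ w → G.Adj u w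

/-- The paw graph: a triangle `{0,1,2}` together with the pendant vertex `3`
adjacent to `0` only. -/
def pawGraph : SimpleGraph (Fin 4) :=
  SimpleGraph.fromEdgeSet {s(0, 1), s(0, 2), s(1, 2), s(0, 3)}

namespace PawAux

variable {V : Type*}

lemma paw_local (G : SimpleGraph V) (hfree : IsEmpty (pawGraph ↪g G))
    (a b c d : V) (hab : G.Adj a b) (hac : G.Adj a c) (hbc : G.Adj b c) (had : G.Adj a d)
    (hdb : d ≠ b) (hdc : d ≠ c) : G.Adj d b ∨ G.Adj d c := by
  by_contra hcon
  push Not at hcon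
  obtain ⟨h1, h2⟩ := hcon
  have h1' : ¬ G.Adj b d := fun h => h1 h.symm
  have h2' : ¬ G.Adj c d := fun h => h2 h.symm
  refine hfree.false ⟨⟨![a, b, c, d], ?_⟩, ?_⟩
  · intro i j hij
    fin_cases i <;> fin_cases j <;>
      simp [hab.ne, hac.ne, hbc.ne, had.ne, hab.ne', hac.ne', hbc.ne', had.ne', hdb, hdc,
        hdb.symm, hdc.symm] at hij ⊢
  · intro i j
    change G.Adj (![a, b, c, d] i) (![a, b, c, d] j) ↔ _
    fin_cases i <;> fin_cases j <;>
      simp [pawGraph, hab, hac, hbc, had, hab.symm, hac.symm, hbc.symm, had.symm, h1, h2, h1', h2']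

/-- False twins. -/
def twin (G : SimpleGraph V) : Setoid V where
  r u v := ∀ w, G.Adj u w ↔ G.Adj v w
  iseqv := ⟨fun _ _ => Iff.rfl, fun h w => (h w).symm, fun h k w => (h w).trans (k w)⟩

/-- The vertex lies in a triangle. -/
def InTri (G : SimpleGraph V) (v : V) : Prop := ∃ a b, G.Adj v a ∧ G.Adj v b ∧ G.Adj a b

lemma edge_tri (G : SimpleGraph V) (hfree : IsEmpty (pawGraph ↪g G)) {v u : V}
    (hv : InTri G v) (h : G.Adj v u) : ∃ t, G.Adj v t ∧ G.Adj u t := by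
  obtain ⟨a, b, h1, h2, h3⟩ := hv
  by_cases hua : u = a
  · subst hua; exact ⟨b, h2, h3⟩
  by_cases hub : u = b
  · subst hub; exact ⟨a, h1, h3.symm⟩
  rcases paw_local G hfree v a b u h1 h2 h3 h hua hub with k | k
  · exact ⟨a, h1, k⟩
  · exact ⟨b, h2, k⟩

lemma InTri.adj {G : SimpleGraph V} (hfree : IsEmpty (pawGraph ↪g G)) {v u : V}
    (hv : InTri G v) (h : G.Adj v u) : InTri G u := by
  obtain ⟨t, h1, h2⟩ := edge_tri G hfree hv h
  exact ⟨v, t, h.symm, h2, h1⟩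

lemma twin_half (G : SimpleGraph V) (hfree : IsEmpty (pawGraph ↪g G)) {u v w : V}
    (hv : InTri G v) (huv : G.Adj v u) (hvw : G.Adj v w) (huw : ¬ G.Adj u w) (hne : u ≠ w)
    (x : V) (hx : G.Adj u x) : G.Adj w x := by
  -- a neighbour of `w` outside `u` and on a triangle with `u` forces adjacency
  have key : ∀ p q, G.Adj u p → G.Adj p q → G.Adj u q → G.Adj w p → G.Adj w q := by
    intro p q h1 h2 h3 h4
    have hq : w ≠ q := by rintro rfl; exact huw h3
    rcases paw_local G hfree p u q w h1.symm h2 h3 h4.symm hne.symm hq with k | k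
    · exact absurd k.symm huw
    · exact k
  obtain ⟨t, ht1, ht2⟩ := edge_tri G hfree hv huv
  have hwt : G.Adj w t := key v t huv.symm ht1 ht2 hvw.symm
  by_cases hxv : x = v
  · subst hxv; exact hvw.symm
  by_cases hxt : x = t
  · subst hxt; exact hwt
  rcases paw_local G hfree u v t x huv.symm ht2 ht1 hx hxv hxt with k | k
  · exact key v x huv.symm k.symm hx hvw.symm
  · exact key t x ht2 k.symm hx hwt

lemma twin_of (G : SimpleGraph V) (hfree : IsEmpty (pawGraph ↪g G)) {u v w : V}
    (hv : InTri G v) (huv : G.Adj v u) (hvw : G.Adj v w) (huw : ¬ G.Adj u w) :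
    ∀ x, G.Adj u x ↔ G.Adj w x := by
  by_cases hne : u = w
  · subst hne; exact fun _ => Iff.rfl
  intro x
  exact ⟨twin_half G hfree hv huv hvw huw hne x,
    twin_half G hfree hv hvw huv (fun h => huw h.symm) (Ne.symm hne) x⟩

/-- Ranks inside the classes of a setoid on a finite type, plus an orientation key. -/
lemma exists_rank [Finite V] (s : Setoid V) :
    ∃ (r : V → ℕ) (k : V → ℕ),
      (∀ u v, s u v → r u = r v → u = v) ∧
      (∀ u v, k u = k v ↔ s u v) ∧
      (∀ u v, k u ≤ k v → ∃ q, s v q ∧ r q = r u) := by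
  classical
  have := Fintype.ofFinite V
  let C : Quotient s → Type _ := fun c => {v : V // Quotient.mk s v = c}
  let e : ∀ c, C c ≃ Fin (Fintype.card (C c)) := fun c => Fintype.equivFin _
  let N := Fintype.card (Quotient s)
  let f : Quotient s ≃ Fin N := Fintype.equivFin _
  let K : Quotient s → ℕ := fun c => (f c : ℕ) + N * Fintype.card (C c)
  have hdiv : ∀ c, K c / N = Fintype.card (C c) := by
    intro c
    have hN : 0 < N := Fintype.card_pos_iff.mpr ⟨c⟩
    simp only [K]
    rw [Nat.add_mul_div_left _ _ hN, Nat.div_eq_of_lt (f c).2, zero_add]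
  have hmod : ∀ c, K c % N = f c := by
    intro c
    simp only [K]
    rw [Nat.add_mul_mod_self_left, Nat.mod_eq_of_lt (f c).2]
  have hr : ∀ (c d : Quotient s) (x : C c) (y : C d), c = d →
      (e c x : ℕ) = e d y → x.1 = y.1 := by
    rintro c d x y rfl h
    rw [(e c).injective (Fin.ext h)]
  refine ⟨fun v => e (Quotient.mk s v) ⟨v, rfl⟩, fun v => K (Quotient.mk s v), ?_, ?_, ?_⟩
  · intro u v huv h
    exact hr _ _ _ _ (Quotient.sound huv) h
  · intro u v
    constructor
    · intro h
      apply Quotient.exact (s := s)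
      apply f.injective
      apply Fin.ext
      rw [← hmod, ← hmod]
      exact congrArg (· % N) h
    · intro h
      exact congrArg K (Quotient.sound h)
  · intro u v h
    have hc : Fintype.card (C (Quotient.mk s u)) ≤ Fintype.card (C (Quotient.mk s v)) := by
      rw [← hdiv, ← hdiv]
      exact Nat.div_le_div_right h
    let i : Fin (Fintype.card (C (Quotient.mk s v))) :=
      ⟨e (Quotient.mk s u) ⟨u, rfl⟩, lt_of_lt_of_le (Fin.is_lt _) hc⟩
    obtain ⟨⟨q, hq⟩, hqi⟩ := (e (Quotient.mk s v)).surjective i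
    refine ⟨q, Quotient.exact hq.symm, ?_⟩
    have h2 : ∀ (c : Quotient s) (h : Quotient.mk s q = c),
        (e (Quotient.mk s q) ⟨q, rfl⟩ : ℕ) = e c ⟨q, h⟩ := by
      rintro c rfl; rfl
    change (e (Quotient.mk s q) ⟨q, rfl⟩ : ℕ) = _
    rw [h2 _ hq, hqi]

end PawAux

open PawAux in
theorem paw_free_optimal_cluster_labeling {V : Type*} [Fintype V]
    (G : SimpleGraph V) (hfree : IsEmpty (pawGraph ↪g G)) :
    ∃ S : Set (Sym2 V), IsSTCLabeling G S ∧
      (∀ S' : Set (Sym2 V), IsSTCLabeling G S' → S'.ncard ≤ S.ncard) ∧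
      (∀ u v w : V, s(u, v) ∈ S → s(v, w) ∈ S → u ≠ w → s(u, w) ∈ S) := by
  classical
  obtain ⟨M, hM, hmax⟩ : ∃ M, IsSTCLabeling G M ∧
      ∀ S' : Set (Sym2 V), IsSTCLabeling G S' → S'.ncard ≤ M.ncard := by
    have := Set.exists_max_image {S : Set (Sym2 V) | IsSTCLabeling G S} Set.ncard
      (Set.toFinite _) ⟨∅, by simp [IsSTCLabeling]⟩
    simpa using this
  obtain ⟨r, k, hr, hk, hq⟩ := exists_rank (twin G)
  have tw : ∀ {u v : V}, twin G u v → ∀ w, G.Adj u w ↔ G.Adj v w := fun h => h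
  have hadj : ∀ {u v}, s(u, v) ∈ M → G.Adj u v := fun h => hM.1 h
  let A : Set (Sym2 V) := {e | e ∈ M ∧ ¬ ∃ x ∈ e, InTri G x}
  let B : Set (Sym2 V) := {e | e ∈ M ∧ ∃ x ∈ e, InTri G x}
  let C : Set (Sym2 V) := {e | ∃ u v, e = s(u, v) ∧ G.Adj u v ∧ r u = r v ∧ InTri G u ∧ InTri G v}
  have memA : ∀ u v, s(u, v) ∈ A ↔ s(u, v) ∈ M ∧ ¬ InTri G u ∧ ¬ InTri G v := by
    intro u v; simp [A]
  have memC : ∀ u v, s(u, v) ∈ C ↔ G.Adj u v ∧ r u = r v ∧ InTri G u ∧ InTri G v := by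
    intro u v
    constructor
    · rintro ⟨a, b, h, h1, h2, h3, h4⟩
      rcases Sym2.eq_iff.mp h with ⟨rfl, rfl⟩ | ⟨rfl, rfl⟩
      · exact ⟨h1, h2, h3, h4⟩
      · exact ⟨h1.symm, h2.symm, h4, h3⟩
    · intro h; exact ⟨u, v, rfl, h⟩
  have clus : ∀ u v w : V, s(u, v) ∈ A ∪ C → s(v, w) ∈ A ∪ C → u ≠ w → s(u, w) ∈ C := by
    intro u v w h1 h2 hne
    rcases h1 with h1 | h1 <;> rcases h2 with h2 | h2 <;>
      simp only [memA, memC] at h1 h2 ⊢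
    · have h := hM.2 u v w h1.1 h2.1 hne
      exact absurd ⟨v, w, hadj h1.1, h, hadj h2.1⟩ h1.2.1
    · exact absurd h2.2.2.1 h1.2.2
    · exact absurd h1.2.2.2 h2.2.1
    · refine ⟨?_, h1.2.1.trans h2.2.1, h1.2.2.1, h2.2.2.2⟩
      by_contra hn
      exact hne (hr u w (twin_of G hfree h1.2.2.2 h1.1.symm h2.1 hn) (h1.2.1.trans h2.2.1))
  have hBC : B.ncard ≤ C.ncard := by
    have hex : ∀ e : Sym2 V, ∃ u v q, e ∈ B →
        e = s(u, v) ∧ k u ≤ k v ∧ twin G v q ∧ r q = r u := by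
      intro e
      induction e using Sym2.ind with
      | _ u v =>
        rcases le_total (k u) (k v) with h | h
        · obtain ⟨q, h1, h2⟩ := hq u v h
          exact ⟨u, v, q, fun _ => ⟨rfl, h, h1, h2⟩⟩
        · obtain ⟨q, h1, h2⟩ := hq v u h
          exact ⟨v, u, q, fun _ => ⟨Sym2.eq_swap, h, h1, h2⟩⟩
    choose U W Q hUWQ using hex
    refine Set.ncard_le_ncard_of_injOn (fun e => s(U e, Q e)) ?_ ?_ (Set.toFinite _)
    · intro e he
      obtain ⟨h1, h2, h3, h4⟩ := hUWQ e he
      have hM' : s(U e, W e) ∈ M := h1 ▸ he.1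
      have ha := hadj hM'
      have haq : G.Adj (U e) (Q e) := ((tw h3 (U e)).mp ha.symm).symm
      have hT : InTri G (U e) := by
        obtain ⟨x, hx, hxT⟩ := he.2
        rw [h1, Sym2.mem_iff] at hx
        rcases hx with hx | hx
        · exact hx ▸ hxT
        · rw [hx] at hxT
          exact hxT.adj hfree ha.symm
      exact (memC _ _).mpr ⟨haq, h4.symm, hT, hT.adj hfree haq⟩
    · intro e he e' he' heq
      obtain ⟨h1, h2, h3, h4⟩ := hUWQ e he
      obtain ⟨h1', h2', h3', h4'⟩ := hUWQ e' he'
      have hm : s(U e, W e) ∈ M := h1 ▸ he.1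
      have hm' : s(U e', W e') ∈ M := h1' ▸ he'.1
      rcases Sym2.eq_iff.mp heq with ⟨g1, g2⟩ | ⟨g1, g2⟩
      · rw [h1, h1', ← g1]
        rw [← g1] at hm'
        by_contra hne
        have hW : W e ≠ W e' := fun h => hne (by rw [h])
        have hww := hM.2 (W e) (U e) (W e') (Sym2.eq_swap ▸ hm) hm' hW
        have : twin G (W e) (W e') := (twin G).trans h3 (g2 ▸ (twin G).symm h3')
        exact G.loopless.irrefl _ ((tw this _).mp hww)
      · exfalso
        have e1 := (hk _ _).mpr h3
        have e2 := (hk _ _).mpr h3'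
        rw [← g1] at e2
        rw [g2] at e1
        have : k (U e) = k (W e) := by omega
        have ht := (hk _ _).mp this
        exact G.loopless.irrefl _ ((tw ht _).mp (hadj hm))
  have hMAB : M = A ∪ B := by
    ext e
    simp only [A, B, Set.mem_union, Set.mem_ofPred_eq]
    tauto
  have hdis : Disjoint A C := by
    rw [Set.disjoint_left]
    intro e
    induction e using Sym2.ind with
    | _ u v =>
      rw [memA, memC]
      tauto
  have hcard : M.ncard ≤ (A ∪ C).ncard := by
    rw [Set.ncard_union_eq hdis (Set.toFinite _) (Set.toFinite _), hMAB]
    exact (Set.ncard_union_le A B).trans (by omega)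
  refine ⟨A ∪ C, ⟨?_, ?_⟩, fun S' h => (hmax S' h).trans hcard,
    fun u v w h1 h2 h3 => Or.inr (clus u v w h1 h2 h3)⟩
  · rintro e (he | he)
    · exact hM.1 he.1
    · obtain ⟨u, v, rfl, h, -⟩ := he
      exact h
  · intro u v w h1 h2 h3
    exact ((memC _ _).mp (clus u v w h1 h2 h3)).1
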